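/- Let m ∈ ℕ and let ω ∈ L²(−1,1) be m times continuously differentiable on (−1,1) with ∫_{−1}^{1} |ω^{(m)}(ξ)|² (1−ξ²)^m dξ < ∞. Then ∫_{−1}^{1} |ω^{(m)}(ξ)|² (1−ξ²)^m dξ = Σ_{n=m}^{∞} (2(n+m)! / ((2n+1)(n−m)!)) · |ω̂_n|², where ω̂_n is the n-th Legendre coefficient of ω. -/

import Mathlib

open MeasureTheory Set

/-- The Legendre polynomial of degree `n` via Rodrigues' formula. -/
noncomputable def legendre (n : ℕ) (x : ℝ) : ℝ :=
  (1 / ((2 : ℝ) ^ n * (Nat.factorial n : ℝ))) *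
    iteratedDeriv n (fun y : ℝ => (y ^ 2 - 1) ^ n) x

/-- The `n`-th Legendre coefficient of `f`. -/
noncomputable def legCoeff (f : ℝ → ℝ) (n : ℕ) : ℝ :=
  ((2 * (n : ℝ) + 1) / 2) * ∫ x in (-1 : ℝ)..1, f x * legendre n x

section IntegrationByParts

open Polynomial Filter Topology

theorem iterate_derivative_comp_C_mul_X (p : ℝ[X]) (s : ℝ) (k : ℕ) :
    derivative^[k] (p.comp (C s * X)) = C (s ^ k) * (derivative^[k] p).comp (C s * X) := by
  induction k with
  | zero => simp
  | succ k ih =>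
    rw [Function.iterate_succ_apply', ih, Function.iterate_succ_apply']
    simp only [derivative_mul, derivative_C, derivative_comp, derivative_X, pow_succ, C_mul]
    ring

/-- Repeated integration by parts on `[-r, r]` against a polynomial vanishing to order `k` at both
end points. -/
theorem integral_iteratedDerivWithin_mul_eval {m : ℕ} {ω : ℝ → ℝ}
    (hω : ContDiffOn ℝ (m : ℕ∞) ω (Ioo (-1 : ℝ) 1)) {r : ℝ} (hr0 : 0 ≤ r) (hr1 : r < 1) {d : ℝ[X]}
    (hd : d.eval r = 0) (hd' : d.eval (-r) = 0) {k : ℕ} (hk : k ≤ m) {W : ℝ[X]} (hW : d ^ k ∣ W) :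
    ∫ x in -r..r, iteratedDerivWithin k ω (Ioo (-1 : ℝ) 1) x * W.eval x =
      (-1) ^ k * ∫ x in -r..r, ω x * (derivative^[k] W).eval x := by
  have hsub : uIcc (-r) r ⊆ Ioo (-1 : ℝ) 1 := by
    rw [uIcc_of_le (by linarith)]
    exact Icc_subset_Ioo (by linarith) hr1
  have huniq : UniqueDiffOn ℝ (Ioo (-1 : ℝ) 1) := isOpen_Ioo.uniqueDiffOn
  induction k generalizing W with
  | zero => simp
  | succ k ih =>
    have hderiv : ∀ x ∈ uIcc (-r) r, HasDerivAt (iteratedDerivWithin k ω (Ioo (-1 : ℝ) 1))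
        (iteratedDerivWithin (k + 1) ω (Ioo (-1 : ℝ) 1) x) x := fun x hx => by
      have hdiff := hω.differentiableOn_iteratedDerivWithin (m := k) (by exact_mod_cast hk) huniq
      rw [iteratedDerivWithin_succ]
      exact (hdiff x (hsub hx)).hasDerivWithinAt.hasDerivAt (isOpen_Ioo.mem_nhds (hsub hx))
    have hcont := (hω.continuousOn_iteratedDerivWithin (m := k + 1)
      (by exact_mod_cast hk) huniq).mono hsub
    have hparts := intervalIntegral.integral_mul_deriv_eq_deriv_mul
      (fun x _ => W.hasDerivAt x) hderiv
      ((derivative W).continuous.intervalIntegrable _ _) hcont.intervalIntegrable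
    have hdvd : d ∣ W := (dvd_pow_self d k.succ_ne_zero).trans hW
    rw [eval_eq_zero_of_dvd_of_eval_eq_zero hdvd hd,
      eval_eq_zero_of_dvd_of_eval_eq_zero hdvd hd'] at hparts
    have hdvd' : d ^ k ∣ derivative W := by
      simpa using pow_sub_one_dvd_derivative_of_pow_dvd hW
    have hih := ih (by omega) hdvd'
    simp_rw [mul_comm (eval _ _)] at hparts
    rw [hparts, hih, Function.iterate_succ_apply]
    ring

theorem tendsto_integral_mul_eval_scaled {G : ℝ → ℝ} {k : ℕ}
    (hmeas : AEStronglyMeasurable G (volume.restrict (Ioo (-1 : ℝ) 1)))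
    (hint : IntegrableOn (fun x => G x * (1 - x ^ 2) ^ k) (Ioo (-1 : ℝ) 1)) (q : ℝ[X]) :
    Tendsto (fun r : ℝ => ∫ x in -r..r, G x * (q * (1 - X ^ 2) ^ k).eval (r⁻¹ * x)) (𝓝[<] 1)
      (𝓝 (∫ x in Ioo (-1 : ℝ) 1, G x * (q * (1 - X ^ 2) ^ k).eval x)) := by
  obtain ⟨V, hV⟩ : ∃ V : ℝ[X], V = q * (1 - X ^ 2) ^ k := ⟨_, rfl⟩
  rw [← hV]
  obtain ⟨B, hB⟩ := (isCompact_Icc : IsCompact (Icc (-1 : ℝ) 1)).exists_bound_of_continuousOn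
    (f := fun x => q.eval x) q.continuous.continuousOn
  have hmem : ∀ᶠ r : ℝ in 𝓝[<] 1, r ∈ Ioo (0 : ℝ) 1 := Ioo_mem_nhdsLT one_pos
  have hlim : Tendsto (fun r : ℝ => ∫ x in Ioo (-1 : ℝ) 1,
      (Ioc (-r) r).indicator (fun x => G x * V.eval (r⁻¹ * x)) x) (𝓝[<] 1)
      (𝓝 (∫ x in Ioo (-1 : ℝ) 1, G x * V.eval x)) := by
    refine tendsto_integral_filter_of_dominated_convergence
      (fun x => B * ‖G x * (1 - x ^ 2) ^ k‖) ?_ ?_ (hint.norm.const_mul B) ?_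
    · refine Eventually.of_forall fun r => ?_
      refine (hmeas.mul ?_).indicator measurableSet_Ioc
      exact (V.continuous.comp (continuous_const.mul continuous_id)).aestronglyMeasurable
    · filter_upwards [hmem] with r hr
      filter_upwards [ae_restrict_mem measurableSet_Ioo] with x hx
      have hB0 : 0 ≤ B := (norm_nonneg _).trans (hB 0 (by simp))
      by_cases hxr : x ∈ Ioc (-r) r
      · rw [indicator_of_mem hxr, norm_mul, norm_mul, ← mul_assoc, mul_comm B, mul_assoc]
        refine mul_le_mul_of_nonneg_left ?_ (norm_nonneg _)
        have hlow : -1 ≤ r⁻¹ * x := by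
          rw [inv_mul_eq_div, le_div_iff₀ hr.1]; linarith [hxr.1]
        have hupp : r⁻¹ * x ≤ 1 := by
          rw [inv_mul_eq_div, div_le_one hr.1]; exact hxr.2
        have hx2 : x ^ 2 ≤ (r⁻¹ * x) ^ 2 := by
          rw [mul_pow]
          refine le_mul_of_one_le_left (sq_nonneg x) (one_le_pow₀ ?_)
          exact (one_le_inv₀ hr.1).2 hr.2.le
        have hle1 : (r⁻¹ * x) ^ 2 ≤ 1 := by nlinarith
        rw [hV, eval_mul, norm_mul]
        refine mul_le_mul (hB _ ⟨hlow, hupp⟩) ?_ (norm_nonneg _) hB0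
        simp only [eval_pow, eval_sub, eval_one, eval_X, norm_pow]
        refine pow_le_pow_left₀ (norm_nonneg _) ?_ k
        rw [Real.norm_of_nonneg (by linarith), Real.norm_of_nonneg (by linarith)]
        linarith
      · rw [indicator_of_notMem hxr, norm_zero]
        positivity
    · filter_upwards [ae_restrict_mem measurableSet_Ioo] with x hx
      have hcont : Tendsto (fun r : ℝ => G x * V.eval (r⁻¹ * x)) (𝓝[<] 1)
          (𝓝 (G x * V.eval x)) := by
        have hinv : Tendsto (fun r : ℝ => r⁻¹ * x) (𝓝[<] 1) (𝓝 x) := by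
          have h : Tendsto (fun r : ℝ => r⁻¹ * x) (𝓝 1) (𝓝 ((1 : ℝ)⁻¹ * x)) :=
            (tendsto_inv₀ one_ne_zero).mul_const x
          rw [inv_one, one_mul] at h
          exact h.mono_left nhdsWithin_le_nhds
        exact ((V.continuous.tendsto x).comp hinv).const_mul _
      refine hcont.congr' ?_
      have h1 : ∀ᶠ r : ℝ in 𝓝[<] 1, x < r := nhdsWithin_le_nhds (lt_mem_nhds hx.2)
      have h2 : ∀ᶠ r : ℝ in 𝓝[<] 1, -x < r := nhdsWithin_le_nhds (lt_mem_nhds (by linarith [hx.1]))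
      filter_upwards [h1, h2] with r hr1 hr2
      have hxr : x ∈ Ioc (-r) r := ⟨by linarith, hr1.le⟩
      rw [indicator_of_mem hxr]
  refine hlim.congr' ?_
  filter_upwards [hmem] with r hr
  rw [intervalIntegral.integral_of_le (by linarith [hr.1]), setIntegral_indicator measurableSet_Ioc,
    inter_eq_self_of_subset_right]
  exact fun x hx => ⟨by linarith [hx.1, hr.2], hx.2.trans_lt hr.2⟩

/-- Repeated integration by parts on `(-1, 1)` against the weight `(1 - x²)ᵐ`; no boundary behaviour
of `ω` is assumed beyond integrability. -/
theorem setIntegral_iteratedDerivWithin_mul_weight {m : ℕ} {ω : ℝ → ℝ}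
    (hω : ContDiffOn ℝ (m : ℕ∞) ω (Ioo (-1 : ℝ) 1)) (hint : IntegrableOn ω (Ioo (-1 : ℝ) 1))
    (hintm : IntegrableOn (fun x => iteratedDerivWithin m ω (Ioo (-1 : ℝ) 1) x * (1 - x ^ 2) ^ m)
      (Ioo (-1 : ℝ) 1)) (q : ℝ[X]) :
    ∫ x in Ioo (-1 : ℝ) 1, iteratedDerivWithin m ω (Ioo (-1 : ℝ) 1) x *
        (q * (1 - X ^ 2) ^ m).eval x =
      (-1) ^ m * ∫ x in Ioo (-1 : ℝ) 1, ω x * (derivative^[m] (q * (1 - X ^ 2) ^ m)).eval x := by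
  have hcont := hω.continuousOn_iteratedDerivWithin (m := m) le_rfl isOpen_Ioo.uniqueDiffOn
  have hl := tendsto_integral_mul_eval_scaled (hcont.aestronglyMeasurable measurableSet_Ioo) hintm q
  have hright := tendsto_integral_mul_eval_scaled (k := 0) hint.aestronglyMeasurable
    (by simpa using hint) (derivative^[m] (q * (1 - X ^ 2) ^ m))
  simp only [pow_zero, mul_one] at hright
  have hs : Tendsto (fun r : ℝ => (-1) ^ m * (r⁻¹) ^ m) (𝓝[<] 1) (𝓝 ((-1) ^ m * (1 : ℝ)⁻¹ ^ m)) :=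
    (((tendsto_inv₀ one_ne_zero).mono_left nhdsWithin_le_nhds).pow m).const_mul _
  have hlim := hs.mul hright
  rw [inv_one, one_pow, mul_one] at hlim
  refine tendsto_nhds_unique hl (hlim.congr' ?_)
  filter_upwards [Ioo_mem_nhdsLT (one_pos : (0 : ℝ) < 1)] with r hr
  set V : ℝ[X] := q * (1 - X ^ 2) ^ m with hV
  have hdvd : ((1 - X ^ 2 : ℝ[X]).comp (C r⁻¹ * X)) ^ m ∣ V.comp (C r⁻¹ * X) := by
    rw [hV, mul_comp, pow_comp]
    exact dvd_mul_left _ _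
  have hparts := integral_iteratedDerivWithin_mul_eval hω hr.1.le hr.2
    (by simp [inv_mul_cancel₀ hr.1.ne']) (by simp [inv_mul_cancel₀ hr.1.ne']) le_rfl hdvd
  simp only [iterate_derivative_comp_C_mul_X, eval_mul, eval_comp, eval_C, eval_X] at hparts
  rw [hparts, mul_assoc, ← intervalIntegral.integral_const_mul (r⁻¹ ^ m)]
  simp_rw [mul_left_comm (ω _)]

end IntegrationByParts

section LegendrePolynomial

open Polynomial

/-- The Legendre polynomial of degree `n`, as a polynomial. -/
noncomputable def legendrePoly (n : ℕ) : ℝ[X] :=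
  C (1 / ((2 : ℝ) ^ n * (Nat.factorial n : ℝ))) * derivative^[n] ((X ^ 2 - 1) ^ n)

theorem iteratedDeriv_eval (p : ℝ[X]) (n : ℕ) :
    iteratedDeriv n (fun x => p.eval x) = fun x => (derivative^[n] p).eval x := by
  induction n with
  | zero => simp
  | succ n ih =>
    rw [iteratedDeriv_succ, ih, Function.iterate_succ_apply']
    exact funext fun x => Polynomial.deriv _

theorem legendre_eq_eval (n : ℕ) (x : ℝ) : legendre n x = (legendrePoly n).eval x := by
  have h := congrFun (iteratedDeriv_eval ((X ^ 2 - 1) ^ n) n) x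
  simp only [eval_pow, eval_sub, eval_X, eval_one] at h
  rw [legendre, h, legendrePoly, eval_mul, eval_C]

theorem degree_iterate_derivative {p : ℝ[X]} {j k : ℕ} (hp : p.degree = ((j + k : ℕ) : WithBot ℕ)) :
    (derivative^[k] p).degree = j := by
  induction k generalizing p with
  | zero => simpa using hp
  | succ k ih =>
    rw [Function.iterate_succ_apply]
    have hnat : p.natDegree = j + (k + 1) := natDegree_eq_of_degree_eq_some hp
    refine ih ?_
    rw [degree_derivative (by omega), hnat]
    rfl

theorem degree_X_sq_sub_one_pow (n : ℕ) :
    ((X ^ 2 - 1 : ℝ[X]) ^ n).degree = ((n + n : ℕ) : WithBot ℕ) := by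
  have h : (X ^ 2 - 1 : ℝ[X]).degree = ((2 : ℕ) : WithBot ℕ) := by
    rw [← C_1]; exact degree_X_pow_sub_C two_pos 1
  rw [degree_pow, h, ← two_mul, mul_comm, Nat.cast_mul, nsmul_eq_mul, mul_comm]

theorem degree_legendrePoly (n : ℕ) : (legendrePoly n).degree = n := by
  rw [legendrePoly, degree_C_mul (by positivity)]
  exact degree_iterate_derivative (degree_X_sq_sub_one_pow n)

theorem iterate_derivative_X_sq_sub_one_pow (n : ℕ) :
    derivative^[n + n] ((X ^ 2 - 1 : ℝ[X]) ^ n) = C ((n + n).factorial : ℝ) := by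
  have hmonic : ((X ^ 2 - 1 : ℝ[X]) ^ n).Monic := by
    rw [← C_1]; exact (monic_X_pow_sub_C 1 two_ne_zero).pow n
  have hnat := natDegree_eq_of_degree_eq_some (degree_X_sq_sub_one_pow n)
  have hdeg : (derivative^[n + n] ((X ^ 2 - 1 : ℝ[X]) ^ n)).degree ≤ 0 :=
    (degree_iterate_derivative (j := 0) (by simpa using degree_X_sq_sub_one_pow n)).le
  rw [eq_C_of_degree_le_zero hdeg, coeff_iterate_derivative, zero_add, Nat.descFactorial_self,
    ← hnat, hmonic.coeff_natDegree, nsmul_one]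

theorem iterate_derivative_legendrePoly_self (n : ℕ) :
    derivative^[n] (legendrePoly n) =
      C ((n + n).factorial / ((2 : ℝ) ^ n * (Nat.factorial n : ℝ))) := by
  rw [legendrePoly, iterate_derivative_C_mul, ← Function.iterate_add_apply,
    iterate_derivative_X_sq_sub_one_pow, ← C_mul]
  congr 1
  ring

/-- The differential equation satisfied by the derivatives of `(X² - 1)ⁿ`. -/
theorem iterate_derivative_X_sq_sub_one_pow_ode (n k : ℕ) :
    (X ^ 2 - 1) * derivative^[k + 2] ((X ^ 2 - 1 : ℝ[X]) ^ n) +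
      (2 * ((k : ℝ[X]) + 1) - 2 * (n : ℝ[X])) * X * derivative^[k + 1] ((X ^ 2 - 1 : ℝ[X]) ^ n) +
      ((k : ℝ[X]) + 1) * ((k : ℝ[X]) - 2 * (n : ℝ[X])) * derivative^[k] ((X ^ 2 - 1 : ℝ[X]) ^ n) = 0 := by
  induction k with
  | zero =>
    have h : (X ^ 2 - 1) * derivative ((X ^ 2 - 1 : ℝ[X]) ^ n) =
        2 * (n : ℝ[X]) * X * (X ^ 2 - 1) ^ n := by
      cases n with
      | zero => simp
      | succ n =>
        simp only [derivative_pow, derivative_sub, derivative_X, derivative_one, C_eq_natCast,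
          Nat.add_sub_cancel]
        push_cast
        ring
    have h' := congrArg derivative h
    simp only [derivative_mul, derivative_sub, derivative_X_sq, derivative_one, derivative_X,
      derivative_natCast, derivative_ofNat, map_ofNat] at h'
    simp only [Function.iterate_succ_apply, Function.iterate_zero_apply, Nat.cast_zero]
    linear_combination h'
  | succ k ih =>
    have h' := congrArg derivative ih
    simp only [derivative_mul, derivative_sub, derivative_add, derivative_X_sq, derivative_one,
      derivative_X, derivative_natCast, derivative_ofNat, map_ofNat, derivative_zero,
      ← Function.iterate_succ_apply' derivative] at h'
    push_cast
    linear_combination h'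

theorem derivative_weight_mul_legendrePoly (n k : ℕ) :
    derivative (derivative^[k + 1] (legendrePoly n) * (1 - X ^ 2) ^ (k + 1)) =
      C (-(((n : ℝ) + k + 1) * (n - k))) *
        (derivative^[k] (legendrePoly n) * (1 - X ^ 2) ^ k) := by
  have h := iterate_derivative_X_sq_sub_one_pow_ode n (k + n)
  rw [show k + n + 2 = k + 2 + n by ring, show k + n + 1 = k + 1 + n by ring] at h
  simp only [legendrePoly, iterate_derivative_C_mul, ← Function.iterate_add_apply,
    derivative_mul, derivative_C, derivative_pow, derivative_sub, derivative_one, derivative_X,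
    ← Function.iterate_succ_apply' derivative, Nat.add_sub_cancel, Nat.succ_eq_add_one] at h ⊢
  rw [show k + 1 + n + 1 = k + 2 + n by ring]
  push_cast at h ⊢
  simp only [map_neg, map_mul, map_add, map_sub, map_natCast, map_one, map_ofNat]
  linear_combination (-C (1 / ((2 : ℝ) ^ n * (Nat.factorial n : ℝ))) * (1 - X ^ 2) ^ k) * h

theorem iterate_derivative_weight_mul_legendrePoly (n m : ℕ) :
    derivative^[m] (derivative^[m] (legendrePoly n) * (1 - X ^ 2) ^ m) =
      C ((-1) ^ m * ∏ i ∈ Finset.range m, (((n : ℝ) + i + 1) * (n - i))) * legendrePoly n := by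
  induction m with
  | zero => simp
  | succ m ih =>
    rw [Function.iterate_succ_apply, derivative_weight_mul_legendrePoly, iterate_derivative_C_mul,
      ih, ← mul_assoc, ← C_mul, Finset.prod_range_succ]
    congr 2
    ring

theorem prod_legendre_eigenvalues (j m : ℕ) :
    ∏ i ∈ Finset.range m, ((((j + m : ℕ) : ℝ) + i + 1) * (((j + m : ℕ) : ℝ) - i)) =
      ((j + 2 * m).factorial : ℝ) / (j.factorial : ℝ) := by
  induction m generalizing j with
  | zero => simp [div_self (Nat.cast_ne_zero (R := ℝ).2 j.factorial_ne_zero)]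
  | succ m ih =>
    rw [Finset.prod_range_succ, show j + (m + 1) = j + 1 + m by ring, ih,
      show j + 2 * (m + 1) = j + 1 + 2 * m + 1 by ring, Nat.factorial_succ (j + 1 + 2 * m),
      Nat.factorial_succ j]
    have := Nat.cast_ne_zero (R := ℝ).2 j.factorial_ne_zero
    push_cast
    field_simp
    ring

theorem iteratedDerivWithin_Ioo_eval (p : ℝ[X]) (m : ℕ) {x : ℝ} (hx : x ∈ Ioo (-1 : ℝ) 1) :
    iteratedDerivWithin m (fun x => p.eval x) (Ioo (-1 : ℝ) 1) x = (derivative^[m] p).eval x := by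
  rw [iteratedDerivWithin_of_isOpen isOpen_Ioo hx, iteratedDeriv_eval]

theorem integrableOn_Ioo_of_continuous {f : ℝ → ℝ} (hf : Continuous f) (a b : ℝ) :
    IntegrableOn f (Ioo a b) :=
  (hf.integrableOn_Icc).mono_set Ioo_subset_Icc_self

theorem setIntegral_iterate_derivative_mul_weight (p q : ℝ[X]) (m : ℕ) :
    ∫ x in Ioo (-1 : ℝ) 1, (derivative^[m] p).eval x * (q * (1 - X ^ 2) ^ m).eval x =
      (-1) ^ m * ∫ x in Ioo (-1 : ℝ) 1, p.eval x * (derivative^[m] (q * (1 - X ^ 2) ^ m)).eval x := by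
  have hp : ContDiff ℝ (m : ℕ∞) (fun x => p.eval x) := by
    simpa only [coe_aeval_eq_eval] using Polynomial.contDiff_aeval (𝕜 := ℝ) p (m : ℕ∞)
  have hint : IntegrableOn (fun x => iteratedDerivWithin m (fun x => p.eval x) (Ioo (-1 : ℝ) 1) x *
      (1 - x ^ 2) ^ m) (Ioo (-1 : ℝ) 1) := by
    refine (integrableOn_Ioo_of_continuous (f := fun x => (derivative^[m] p).eval x *
      (1 - x ^ 2) ^ m) (by fun_prop) _ _).congr_fun (fun x hx => ?_) measurableSet_Ioo
    simp only [iteratedDerivWithin_Ioo_eval p m hx]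
  rw [← setIntegral_iteratedDerivWithin_mul_weight hp.contDiffOn
    (integrableOn_Ioo_of_continuous p.continuous _ _) hint q]
  refine setIntegral_congr_fun measurableSet_Ioo fun x hx => ?_
  simp only [iteratedDerivWithin_Ioo_eval p m hx]

theorem setIntegral_mul_legendrePoly (p : ℝ[X]) (n : ℕ) :
    ∫ x in Ioo (-1 : ℝ) 1, p.eval x * (legendrePoly n).eval x =
      1 / ((2 : ℝ) ^ n * (Nat.factorial n : ℝ)) *
        ∫ x in Ioo (-1 : ℝ) 1, (derivative^[n] p).eval x * (1 - x ^ 2) ^ n := by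
  have h := setIntegral_iterate_derivative_mul_weight p 1 n
  have hneg : (1 - X ^ 2 : ℝ[X]) ^ n = C ((-1) ^ n) * (X ^ 2 - 1) ^ n := by
    rw [C_pow, ← mul_pow]; congr 1; simp
  have hsq : ((-1 : ℝ) ^ n) * (-1) ^ n = 1 := by rw [← mul_pow]; simp
  have heval : ∀ x : ℝ, ((1 - X ^ 2 : ℝ[X]) ^ n).eval x = (1 - x ^ 2) ^ n := by simp
  rw [one_mul] at h
  simp_rw [heval] at h
  rw [h, hneg, iterate_derivative_C_mul]
  simp only [legendrePoly, eval_mul, eval_C]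
  simp_rw [fun x => mul_left_comm (p.eval x) ((-1 : ℝ) ^ n),
    fun x => mul_left_comm (p.eval x) (1 / ((2 : ℝ) ^ n * (Nat.factorial n : ℝ))),
    integral_const_mul]
  rw [← mul_assoc ((-1 : ℝ) ^ n), hsq, one_mul]

theorem setIntegral_legendrePoly_mul_of_lt {i n : ℕ} (h : i < n) :
    ∫ x in Ioo (-1 : ℝ) 1, (legendrePoly i).eval x * (legendrePoly n).eval x = 0 := by
  rw [setIntegral_mul_legendrePoly, iterate_derivative_eq_zero]
  · simp
  · rwa [natDegree_eq_of_degree_eq_some (degree_legendrePoly i)]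

theorem setIntegral_legendrePoly_mul_of_ne {i n : ℕ} (h : i ≠ n) :
    ∫ x in Ioo (-1 : ℝ) 1, (legendrePoly i).eval x * (legendrePoly n).eval x = 0 := by
  rcases h.lt_or_gt with h | h
  · exact setIntegral_legendrePoly_mul_of_lt h
  · simp_rw [mul_comm (eval _ (legendrePoly i))]
    exact setIntegral_legendrePoly_mul_of_lt h

theorem setIntegral_one_sub_sq_pow (n : ℕ) :
    ∫ x in Ioo (-1 : ℝ) 1, (1 - x ^ 2) ^ n =
      2 ^ (2 * n + 1) * (n.factorial : ℝ) ^ 2 / ((2 * n + 1).factorial : ℝ) := by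
  rw [← integral_Ioc_eq_integral_Ioo, ← intervalIntegral.integral_of_le (by norm_num)]
  induction n with
  | zero => norm_num
  | succ n ih =>
    have hderiv : ∀ x ∈ uIcc (-1 : ℝ) 1, HasDerivAt (fun x : ℝ => x * (1 - x ^ 2) ^ (n + 1))
        ((2 * n + 3) * (1 - x ^ 2) ^ (n + 1) - 2 * (n + 1) * (1 - x ^ 2) ^ n) x := fun x _ => by
      have h := (hasDerivAt_id x).mul ((((hasDerivAt_id x).pow 2).const_sub 1).pow (n + 1))
      refine h.congr_deriv ?_
      simp only [id, Nat.add_sub_cancel, Pi.pow_apply]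
      push_cast
      ring
    have hrec := intervalIntegral.integral_eq_sub_of_hasDerivAt hderiv
      (Continuous.intervalIntegrable (by fun_prop) _ _)
    rw [intervalIntegral.integral_sub (Continuous.intervalIntegrable (by fun_prop) _ _)
      (Continuous.intervalIntegrable (by fun_prop) _ _), intervalIntegral.integral_const_mul,
      intervalIntegral.integral_const_mul, ih] at hrec
    norm_num at hrec
    have hpos : (2 * (n : ℝ) + 3) ≠ 0 := by positivity
    refine mul_left_cancel₀ hpos ?_
    rw [sub_eq_zero.1 hrec, show 2 * (n + 1) + 1 = 2 * n + 1 + 1 + 1 by ring,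
      Nat.factorial_succ (2 * n + 1 + 1), Nat.factorial_succ (2 * n + 1), Nat.factorial_succ n]
    have := Nat.cast_ne_zero (R := ℝ).2 (2 * n + 1).factorial_ne_zero
    push_cast
    field_simp
    ring

theorem setIntegral_legendrePoly_mul_self (n : ℕ) :
    ∫ x in Ioo (-1 : ℝ) 1, (legendrePoly n).eval x * (legendrePoly n).eval x = 2 / (2 * n + 1) := by
  rw [setIntegral_mul_legendrePoly, iterate_derivative_legendrePoly_self]
  simp only [eval_C]
  rw [integral_const_mul, setIntegral_one_sub_sq_pow, Nat.factorial_succ, ← two_mul]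
  have h1 := Nat.cast_ne_zero (R := ℝ).2 (2 * n).factorial_ne_zero
  have h2 := Nat.cast_ne_zero (R := ℝ).2 n.factorial_ne_zero
  push_cast
  field_simp
  ring

end LegendrePolynomial

section Parseval

open Polynomial

variable {μ : Measure ℝ} [IsFiniteMeasure μ]

theorem memLp_two_eval (hμ : ∀ᵐ x ∂μ, x ∈ Icc (-1 : ℝ) 1) (p : ℝ[X]) :
    MemLp (fun x => p.eval x) 2 μ := by
  obtain ⟨B, hB⟩ := (isCompact_Icc : IsCompact (Icc (-1 : ℝ) 1)).exists_bound_of_continuousOn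
    (f := fun x => p.eval x) p.continuous.continuousOn
  exact MemLp.of_bound p.continuous.aestronglyMeasurable B (hμ.mono hB)

theorem exists_integral_sub_eval_sq_le (hμ : ∀ᵐ x ∂μ, x ∈ Icc (-1 : ℝ) 1) {f : ℝ → ℝ}
    (hf : MemLp f 2 μ) {ε : ℝ} (hε : 0 < ε) :
    ∃ p : ℝ[X], ∫ x, (f x - p.eval x) ^ 2 ∂μ ≤ ε := by
  have hf' : MemLp f (ENNReal.ofReal 2) μ := by simpa using hf
  obtain ⟨g, hg, hgmem⟩ := hf'.exists_boundedContinuous_integral_rpow_sub_le two_pos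
    (show 0 < ε / 4 by positivity)
  have hg2 : MemLp (fun x => g x) 2 μ := by simpa using hgmem
  simp only [Real.rpow_two, Real.norm_eq_abs, sq_abs] at hg
  set M : ℝ := μ.real univ with hM
  have hM0 : 0 ≤ M := measureReal_nonneg
  have hδ : 0 < ε / (4 * (M + 1)) := by positivity
  obtain ⟨p, hp⟩ := exists_polynomial_near_of_continuousOn (-1) 1 g g.continuous.continuousOn
    (Real.sqrt (ε / (4 * (M + 1)))) (Real.sqrt_pos.2 hδ)
  refine ⟨p, ?_⟩
  have hfg : Integrable (fun x => (f x - g x) ^ 2) μ := (hf.sub hg2).integrable_sq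
  have hle : ∫ x, (f x - p.eval x) ^ 2 ∂μ ≤
      ∫ x, (2 * (f x - g x) ^ 2 + 2 * (ε / (4 * (M + 1)))) ∂μ := by
    refine integral_mono_ae (hf.sub (memLp_two_eval hμ p)).integrable_sq
      ((hfg.const_mul 2).add (integrable_const _)) ?_
    filter_upwards [hμ] with x hx
    have h1 : (p.eval x - g x) ^ 2 ≤ ε / (4 * (M + 1)) := by
      rw [← sq_abs, ← Real.sq_sqrt hδ.le]
      exact pow_le_pow_left₀ (abs_nonneg _) (hp x hx).le 2
    have h2 := sq_nonneg ((f x - g x) + (p.eval x - g x))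
    nlinarith
  rw [integral_add (hfg.const_mul 2) (integrable_const _), integral_const_mul, integral_const,
    ← hM, smul_eq_mul] at hle
  have hMε : M * (2 * (ε / (4 * (M + 1)))) ≤ ε / 2 := by
    rw [← sub_nonneg]
    have : ε / 2 - M * (2 * (ε / (4 * (M + 1)))) = ε / (2 * (M + 1)) := by field_simp; ring
    rw [this]; positivity
  linarith

theorem integral_sub_sum_sq (hμ : ∀ᵐ x ∂μ, x ∈ Icc (-1 : ℝ) 1) {q : ℕ → ℝ[X]} {h : ℕ → ℝ}
    (horth : ∀ i j, ∫ x, (q i).eval x * (q j).eval x ∂μ = if i = j then h i else 0)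
    (hpos : ∀ i, 0 < h i) {f : ℝ → ℝ} (hf : MemLp f 2 μ) (s : Finset ℕ) (a : ℕ → ℝ) :
    ∫ x, (f x - (∑ i ∈ s, a i • q i).eval x) ^ 2 ∂μ =
      ∫ x, f x ^ 2 ∂μ - ∑ i ∈ s, (∫ x, f x * (q i).eval x ∂μ) ^ 2 / h i +
        ∑ i ∈ s, h i * (a i - (∫ x, f x * (q i).eval x ∂μ) / h i) ^ 2 := by
  have hq := memLp_two_eval hμ
  set g : ℝ[X] := ∑ i ∈ s, a i • q i with hg
  have heval : ∀ x, g.eval x = ∑ i ∈ s, a i * (q i).eval x := fun x => by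
    simp [hg, eval_finsetSum]
  have hfq : ∀ p : ℝ[X], Integrable (fun x => f x * p.eval x) μ := fun p =>
    hf.integrable_mul (hq p)
  have hqq : ∀ p r : ℝ[X], Integrable (fun x => p.eval x * r.eval x) μ := fun p r =>
    (hq p).integrable_mul (hq r)
  have hexpand : ∀ x, (f x - g.eval x) ^ 2 =
      f x ^ 2 - 2 * (f x * g.eval x) + g.eval x * g.eval x := fun x => by ring
  have hcross : ∫ x, f x * g.eval x ∂μ = ∑ i ∈ s, a i * ∫ x, f x * (q i).eval x ∂μ := by
    simp_rw [heval, Finset.mul_sum, mul_left_comm (f _)]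
    rw [integral_finsetSum _ fun i _ => (hfq (q i)).const_mul (a i)]
    simp_rw [integral_const_mul]
  have hself : ∫ x, g.eval x * g.eval x ∂μ = ∑ i ∈ s, a i ^ 2 * h i := by
    have hterm : ∀ x, g.eval x * g.eval x =
        ∑ i ∈ s, ∑ j ∈ s, a i * a j * ((q i).eval x * (q j).eval x) := fun x => by
      rw [heval, Finset.sum_mul_sum]
      exact Finset.sum_congr rfl fun i _ => Finset.sum_congr rfl fun j _ => by ring
    simp_rw [hterm]
    rw [integral_finsetSum _ fun i _ => integrable_finsetSum _ fun j _ =>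
      (hqq (q i) (q j)).const_mul _]
    refine Finset.sum_congr rfl fun i hi => ?_
    rw [integral_finsetSum _ fun j _ => (hqq (q i) (q j)).const_mul _]
    simp_rw [integral_const_mul, horth, mul_ite, mul_zero]
    rw [Finset.sum_ite_eq, if_pos hi]
    ring
  have hdiff : Integrable (fun x => f x ^ 2 - 2 * (f x * g.eval x)) μ :=
    hf.integrable_sq.sub ((hfq g).const_mul 2)
  simp_rw [hexpand]
  rw [integral_add hdiff (hqq g g),
    integral_sub hf.integrable_sq ((hfq g).const_mul 2), integral_const_mul, hcross, hself,
    sub_add, sub_add, Finset.mul_sum, ← Finset.sum_sub_distrib, ← Finset.sum_sub_distrib]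
  congr 1
  refine Finset.sum_congr rfl fun i _ => ?_
  have := (hpos i).ne'
  field_simp
  ring

/-- Parseval's identity for orthogonal polynomials with respect to a finite measure on
`[-1, 1]`. -/
theorem hasSum_sq_integral_mul_div (hμ : ∀ᵐ x ∂μ, x ∈ Icc (-1 : ℝ) 1) {q : ℕ → ℝ[X]} {h : ℕ → ℝ}
    (hdeg : ∀ i, (q i).degree = i)
    (horth : ∀ i j, ∫ x, (q i).eval x * (q j).eval x ∂μ = if i = j then h i else 0)
    (hpos : ∀ i, 0 < h i) {f : ℝ → ℝ} (hf : MemLp f 2 μ) :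
    HasSum (fun i => (∫ x, f x * (q i).eval x ∂μ) ^ 2 / h i) (∫ x, f x ^ 2 ∂μ) := by
  have hid := integral_sub_sum_sq hμ horth hpos hf
  refine hasSum_of_isLUB_of_nonneg _ (fun i => div_nonneg (sq_nonneg _) (hpos i).le) ⟨?_, ?_⟩
  · rintro _ ⟨s, rfl⟩
    have hs := hid s fun i => (∫ x, f x * (q i).eval x ∂μ) / h i
    simp only [sub_self, ne_eq, OfNat.ofNat_ne_zero, not_false_eq_true, zero_pow, mul_zero,
      Finset.sum_const_zero, add_zero] at hs
    exact sub_nonneg.1 (hs ▸ integral_nonneg fun x => sq_nonneg _)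
  · intro b hb
    refine le_of_forall_pos_le_add fun ε hε => ?_
    obtain ⟨p, hp⟩ := exists_integral_sub_eval_sq_le hμ hf hε
    let S : Polynomial.Sequence ℝ := ⟨q, hdeg⟩
    have hspan : p ∈ Submodule.span ℝ (range q) := by
      have : Submodule.span ℝ (range q) = ⊤ :=
        S.span fun i => (leadingCoeff_ne_zero.2 (S.ne_zero i)).isUnit
      rw [this]
      trivial
    obtain ⟨c, rfl⟩ := Finsupp.mem_span_range_iff_exists_finsupp.1 hspan
    have hs := hid c.support c
    rw [Finsupp.sum, hs] at hp
    have hsum : 0 ≤ ∑ i ∈ c.support, h i * (c i - (∫ x, f x * (q i).eval x ∂μ) / h i) ^ 2 :=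
      Finset.sum_nonneg fun i _ => mul_nonneg (hpos i).le (sq_nonneg _)
    have hbs := hb ⟨c.support, rfl⟩
    simp only at hbs
    linarith

end Parseval

section Weight

open Polynomial

/-- The measure `(1 - x²)ᵐ dx` on `(-1, 1)`. -/
noncomputable def weightMeasure (m : ℕ) : Measure ℝ :=
  (volume.restrict (Ioo (-1 : ℝ) 1)).withDensity fun x => ((1 - x ^ 2) ^ m).toNNReal

theorem measurable_weight (m : ℕ) : Measurable fun x : ℝ => ((1 - x ^ 2) ^ m).toNNReal := by
  fun_prop

theorem toNNReal_weight_smul {m : ℕ} (g : ℝ → ℝ) {x : ℝ} (hx : x ∈ Ioo (-1 : ℝ) 1) :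
    ((1 - x ^ 2) ^ m).toNNReal • g x = g x * (1 - x ^ 2) ^ m := by
  have h : 0 ≤ (1 - x ^ 2) ^ m := pow_nonneg (by nlinarith [hx.1, hx.2]) m
  rw [NNReal.smul_def, Real.coe_toNNReal _ h, smul_eq_mul, mul_comm]

theorem integral_weightMeasure (m : ℕ) (g : ℝ → ℝ) :
    ∫ x, g x ∂weightMeasure m = ∫ x in Ioo (-1 : ℝ) 1, g x * (1 - x ^ 2) ^ m := by
  rw [weightMeasure, integral_withDensity_eq_integral_smul (measurable_weight m)]
  exact setIntegral_congr_fun measurableSet_Ioo fun x hx => toNNReal_weight_smul g hx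

theorem integrable_weightMeasure {m : ℕ} {g : ℝ → ℝ} :
    Integrable g (weightMeasure m) ↔
      IntegrableOn (fun x => g x * (1 - x ^ 2) ^ m) (Ioo (-1 : ℝ) 1) := by
  rw [weightMeasure, integrable_withDensity_iff_integrable_smul (measurable_weight m)]
  exact integrableOn_congr_fun (fun x hx => toNNReal_weight_smul g hx) measurableSet_Ioo

theorem weightMeasure_absolutelyContinuous (m : ℕ) :
    weightMeasure m ≪ volume.restrict (Ioo (-1 : ℝ) 1) :=
  withDensity_absolutelyContinuous _ _

instance isFiniteMeasure_weightMeasure (m : ℕ) : IsFiniteMeasure (weightMeasure m) :=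
  (integrable_const_iff_isFiniteMeasure (c := (1 : ℝ)) one_ne_zero).1 <|
    integrable_weightMeasure.2 <| integrableOn_Ioo_of_continuous (by fun_prop) _ _

theorem setIntegral_mul_iterate_derivative_legendrePoly {m : ℕ} {f g : ℝ → ℝ} (j : ℕ)
    (hparts : ∀ q : ℝ[X], ∫ x in Ioo (-1 : ℝ) 1, f x * (q * (1 - X ^ 2) ^ m).eval x =
      (-1) ^ m * ∫ x in Ioo (-1 : ℝ) 1, g x * (derivative^[m] (q * (1 - X ^ 2) ^ m)).eval x) :
    ∫ x, f x * (derivative^[m] (legendrePoly (j + m))).eval x ∂weightMeasure m =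
      ((j + 2 * m).factorial : ℝ) / (j.factorial : ℝ) *
        ∫ x in Ioo (-1 : ℝ) 1, g x * (legendrePoly (j + m)).eval x := by
  have h := hparts (derivative^[m] (legendrePoly (j + m)))
  rw [iterate_derivative_weight_mul_legendrePoly, prod_legendre_eigenvalues] at h
  simp only [eval_mul, eval_C, eval_pow, eval_sub, eval_one, eval_X, mul_left_comm (g _),
    integral_const_mul, ← mul_assoc (f _)] at h
  have hsq : ((-1 : ℝ) ^ m) * (-1) ^ m = 1 := by rw [← mul_pow]; simp
  rw [integral_weightMeasure, h, ← mul_assoc, ← mul_assoc, hsq, one_mul]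

end Weight

/-- the weighted Parseval identity
`∫_{−1}^{1} |ω^{(m)}(ξ)|² (1−ξ²)^m dξ = Σ_{n=m}^{∞} (2(n+m)!/((2n+1)(n−m)!)) |ω̂_n|²`
(the sum is re-indexed by `n = j + m`). -/
theorem stmt_18 (m : ℕ) (hm : 1 ≤ m) (ω : ℝ → ℝ)
    (hL1 : IntervalIntegrable ω volume (-1) 1)
    (hL2 : IntervalIntegrable (fun x => ω x ^ 2) volume (-1) 1)
    (hsmooth : ContDiffOn ℝ (m : ℕ∞) ω (Set.Ioo (-1 : ℝ) 1))
    (hweight : IntegrableOn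
        (fun ξ => (iteratedDerivWithin m ω (Set.Ioo (-1 : ℝ) 1) ξ) ^ 2 * (1 - ξ ^ 2) ^ m)
        (Set.Ioo (-1 : ℝ) 1) volume) :
    (∫ ξ in (-1 : ℝ)..1,
        (iteratedDerivWithin m ω (Set.Ioo (-1 : ℝ) 1) ξ) ^ 2 * (1 - ξ ^ 2) ^ m) =
      ∑' j : ℕ,
        (2 * (Nat.factorial (j + 2 * m) : ℝ) /
            ((2 * ((j : ℝ) + (m : ℝ)) + 1) * (Nat.factorial j : ℝ))) *
          legCoeff ω (j + m) ^ 2 := by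
  have hIoo : ∀ g : ℝ → ℝ, ∫ x in (-1 : ℝ)..1, g x = ∫ x in Ioo (-1 : ℝ) 1, g x := fun g => by
    rw [intervalIntegral.integral_of_le (by norm_num), integral_Ioc_eq_integral_Ioo]
  have hint : IntegrableOn ω (Ioo (-1 : ℝ) 1) :=
    ((intervalIntegrable_iff_integrableOn_Ioo_of_le (by norm_num)).1 hL1)
  set f : ℝ → ℝ := iteratedDerivWithin m ω (Ioo (-1 : ℝ) 1)
  have hmeas : AEStronglyMeasurable f (weightMeasure m) :=
    ((hsmooth.continuousOn_iteratedDerivWithin (m := m) le_rfl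
      isOpen_Ioo.uniqueDiffOn).aestronglyMeasurable measurableSet_Ioo).mono_ac
      (weightMeasure_absolutelyContinuous m)
  have hmem : MemLp f 2 (weightMeasure m) :=
    (memLp_two_iff_integrable_sq hmeas).2 (integrable_weightMeasure.2 hweight)
  have hparts := setIntegral_iteratedDerivWithin_mul_weight hsmooth hint
    (integrable_weightMeasure.1 (hmem.integrable one_le_two))
  have hsupp : ∀ᵐ x ∂weightMeasure m, x ∈ Icc (-1 : ℝ) 1 :=
    (weightMeasure_absolutelyContinuous m).ae_le <|
      (ae_restrict_mem measurableSet_Ioo).mono fun x hx => Ioo_subset_Icc_self hx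
  have hsum := hasSum_sq_integral_mul_div hsupp
    (q := fun j => Polynomial.derivative^[m] (legendrePoly (j + m)))
    (h := fun j => ((j + 2 * m).factorial : ℝ) / (j.factorial : ℝ) *
      (2 / (2 * ((j + m : ℕ) : ℝ) + 1)))
    (fun j => degree_iterate_derivative (degree_legendrePoly (j + m)))
    (fun i j => by
      rw [setIntegral_mul_iterate_derivative_legendrePoly j fun q =>
        setIntegral_iterate_derivative_mul_weight _ q m]
      split_ifs with hij
      · rw [hij, setIntegral_legendrePoly_mul_self]
      · rw [setIntegral_legendrePoly_mul_of_ne (by omega), mul_zero])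
    (fun j => by positivity) hmem
  rw [hIoo, ← integral_weightMeasure m fun x => f x ^ 2, ← hsum.tsum_eq]
  refine tsum_congr fun j => ?_
  rw [setIntegral_mul_iterate_derivative_legendrePoly j hparts, legCoeff, hIoo]
  simp_rw [legendre_eq_eval]
  have h1 := Nat.cast_ne_zero (R := ℝ).2 j.factorial_ne_zero
  have h2 := Nat.cast_ne_zero (R := ℝ).2 (j + 2 * m).factorial_ne_zero
  push_cast
  field_simp
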